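/- arXiv:2509.17923 — 3 statements merged into one kernel-verified Lean document; each statement's English description precedes it below -/
import Mathlib

section
/- Let n ≥ 2, let B be the open unit ball of ℝⁿ, and let G be an N-function with complementary function G̃(t) = sup{t w − G(w) : w > 0}. There exists a constant C > 0 depending only on n such that for every radial function u ∈ C¹(B̄) vanishing on ∂B and every x ∈ B with r = |x| ∈ (0,1): |u(x)| ≤ C ‖∇u‖_{L^G(B)} · N_G̃(r), where ‖∇u‖_{L^G(B)} = inf{λ > 0 : ∫_B G(|∇u(y)|/λ) dy ≤ 1} is the Luxemburg norm of |∇u| with respect to Lebesgue measure on B, and N_G̃(r) = inf{λ > 0 : ∫_r^1 G̃(s^{1−n}/λ) s^{n−1} ds ≤ 1}. -/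
open MeasureTheory Metric

/-- `G : [0,∞) → [0,∞)` is an N-function with derivative `g = G'`: it is convex, increasing,
vanishes at `0`, is sublinear at `0` and superlinear at `∞`, and is differentiable on `(0,∞)`
with nondecreasing positive derivative `g`. -/
structure IsNFunction (G g : ℝ → ℝ) : Prop where
  map_zero : G 0 = 0
  convex : ConvexOn ℝ (Set.Ici 0) G
  strictMono : StrictMonoOn G (Set.Ici 0)
  hasDeriv : ∀ t > 0, HasDerivAt G (g t) t
  deriv_pos : ∀ t > 0, 0 < g t
  deriv_mono : MonotoneOn g (Set.Ioi 0)
  tendsto_zero : Filter.Tendsto (fun t => G t / t) (nhdsWithin 0 (Set.Ioi 0)) (nhds 0)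
  tendsto_top : Filter.Tendsto (fun t => G t / t) Filter.atTop Filter.atTop

/-- The complementary N-function `G̃(t) = sup { t w - G(w) : w > 0 }`. -/
noncomputable def complementaryFn (G : ℝ → ℝ) (t : ℝ) : ℝ :=
  sSup ((fun w => t * w - G w) '' Set.Ioi 0)

/-- The Luxemburg norm `‖s^{1-n}‖_{L^{G̃}((r,1), s^{n-1} ds)}`. -/
noncomputable def weightedTailNorm (n : ℕ) (G : ℝ → ℝ) (r : ℝ) : ℝ :=
  sInf {l : ℝ | 0 < l ∧
    (∫ s in r..1, complementaryFn G (s ^ ((1:ℝ) - n) / l) * s ^ ((n:ℝ) - 1)) ≤ 1}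

/-- The Luxemburg norm `‖∇u‖_{L^G(B)}` over the unit ball of `ℝⁿ`. -/
noncomputable def gradLuxemburgNorm (n : ℕ) (G : ℝ → ℝ)
    (u : EuclideanSpace ℝ (Fin n) → ℝ) : ℝ :=
  sInf {l : ℝ | 0 < l ∧
    (∫ y in ball (0:EuclideanSpace ℝ (Fin n)) 1, G (‖gradient u y‖ / l)) ≤ 1}


section helpers

variable {G g : ℝ → ℝ}

lemma nf_nonneg (h : IsNFunction G g) {t : ℝ} (ht : 0 ≤ t) : 0 ≤ G t := by
  have := h.strictMono.monotoneOn (Set.mem_Ici.2 le_rfl) (Set.mem_Ici.2 ht) ht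
  rwa [h.map_zero] at this

lemma nf_le_mul (h : IsNFunction G g) {t : ℝ} (ht : 0 ≤ t) (K : ℝ) (hK : 0 ≤ K) (ht1 : t ≤ 1) :
    G (t * K) ≤ t * G K := by
  have := h.convex.2 (Set.mem_Ici.2 (le_refl (0:ℝ)))
    (Set.mem_Ici.2 hK) (sub_nonneg.2 ht1) ht (by ring)
  simpa [h.map_zero] using this

lemma comp_bdd (h : IsNFunction G g) (t : ℝ) :
    BddAbove ((fun w => t * w - G w) '' Set.Ioi 0) := by
  obtain ⟨W, hW⟩ := Filter.eventually_atTop.1 (h.tendsto_top.eventually_ge_atTop t)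
  refine ⟨|t| * |W|, ?_⟩
  rintro _ ⟨w, hw, rfl⟩
  have hw' : 0 < w := hw
  have hp : 0 ≤ |t| * |W| := by positivity
  show t * w - G w ≤ _
  rcases le_total W w with hc | hc
  · have := hW w hc
    rw [le_div_iff₀ hw'] at this
    linarith
  · have h1 := nf_nonneg h hw'.le
    have h2 : t * w ≤ |t| * |W| :=
      mul_le_mul (le_abs_self t) (hc.trans (le_abs_self W)) hw'.le (abs_nonneg t)
    linarith

lemma comp_ge (h : IsNFunction G g) (t : ℝ) {w : ℝ} (hw : 0 < w) :
    t * w - G w ≤ complementaryFn G t :=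
  le_csSup (comp_bdd h t) ⟨w, hw, rfl⟩

lemma comp_mono (h : IsNFunction G g) : Monotone (complementaryFn G) := by
  intro a b hab
  refine csSup_le (Set.Nonempty.image _ ⟨1, by simp⟩) ?_
  rintro _ ⟨w, hw, rfl⟩
  have hw' : 0 < w := hw
  refine le_trans ?_ (comp_ge h b hw')
  show a * w - G w ≤ b * w - G w
  nlinarith

lemma comp_nonneg (h : IsNFunction G g) {t : ℝ} (ht : 0 < t) : 0 ≤ complementaryFn G t := by
  have h1 := h.tendsto_zero.eventually (gt_mem_nhds ht)
  obtain ⟨w, hw, hw0⟩ := (h1.and self_mem_nhdsWithin).exists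
  have hw' : 0 < w := hw0
  rw [div_lt_iff₀ hw'] at hw
  linarith [comp_ge h t hw']

lemma comp_le_mul (h : IsNFunction G g) {t : ℝ} (ht : 0 ≤ t) (ht1 : t ≤ 1) :
    complementaryFn G t ≤ t * complementaryFn G 1 := by
  refine csSup_le (Set.Nonempty.image _ ⟨1, by simp⟩) ?_
  rintro _ ⟨w, hw, rfl⟩
  have hw' : 0 < w := hw
  have h1 := mul_le_mul_of_nonneg_left (comp_ge h 1 hw') ht
  have h2 := nf_nonneg h hw'.le
  show t * w - G w ≤ _
  nlinarith

lemma nf_young (h : IsNFunction G g) {a t : ℝ} (ha : 0 ≤ a) (ht : 0 < t) :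
    a * t ≤ G a + complementaryFn G t := by
  rcases ha.eq_or_lt with rfl | ha
  · simpa [h.map_zero] using comp_nonneg h ht
  · linarith [comp_ge h t ha]

lemma tail_integrable (h : IsNFunction G g) (n : ℕ) (hn : 2 ≤ n) {r m : ℝ} (hr : 0 < r) (hr1 : r < 1)
    (hm : 0 < m) :
    IntervalIntegrable (fun s => complementaryFn G (s ^ ((1:ℝ) - n) / m) * s ^ ((n:ℝ) - 1))
      volume r 1 := by
  have hn' : (2:ℝ) ≤ n := by exact_mod_cast hn
  apply IntervalIntegrable.mul_continuousOn
  · apply AntitoneOn.intervalIntegrable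
    intro a ha b hb hab
    rw [Set.uIcc_of_le hr1.le] at ha hb
    apply comp_mono h
    have : 0 < a := lt_of_lt_of_le hr ha.1
    gcongr ?_ / m
    exact Real.rpow_le_rpow_of_nonpos this hab (by linarith)
  · intro a ha
    rw [Set.uIcc_of_le hr1.le] at ha
    exact (Real.continuousAt_rpow_const _ _ (Or.inr (by linarith))).continuousWithinAt

lemma tail_nonempty (h : IsNFunction G g) (n : ℕ) (hn : 2 ≤ n) {r : ℝ} (hr : 0 < r) (hr1 : r < 1) :
    {l : ℝ | 0 < l ∧ (∫ s in r..1, complementaryFn G (s ^ ((1:ℝ) - n) / l) * s ^ ((n:ℝ) - 1)) ≤ 1}.Nonempty := by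
  have hn' : (2:ℝ) ≤ n := by exact_mod_cast hn
  set K := complementaryFn G 1 with hK
  have hK0 : 0 ≤ K := comp_nonneg h one_pos
  set R := r ^ ((1:ℝ) - n)
  have hR : 0 < R := Real.rpow_pos_of_pos hr _
  have hl : 0 < R * (K + 1) := by positivity
  refine ⟨R * (K + 1), hl, ?_⟩
  have key := intervalIntegral.norm_integral_le_of_norm_le_const (a := r) (b := 1) (C := 1)
    (f := fun s => complementaryFn G (s ^ ((1:ℝ) - n) / (R * (K + 1))) * s ^ ((n:ℝ) - 1)) ?_
  · have h2 := (le_abs_self _).trans key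
    rw [abs_of_pos (by linarith)] at h2
    linarith
  · intro s hs
    rw [Set.uIoc_of_le hr1.le] at hs
    have hs0 : 0 < s := hr.trans hs.1
    have h1 : s ^ ((1:ℝ) - n) ≤ R := Real.rpow_le_rpow_of_nonpos hr hs.1.le (by linarith)
    have h0 : 0 < s ^ ((1:ℝ) - n) := Real.rpow_pos_of_pos hs0 _
    have h3 : s ^ ((n:ℝ) - 1) ≤ 1 := Real.rpow_le_one hs0.le hs.2 (by linarith)
    have h3' : 0 < s ^ ((n:ℝ) - 1) := Real.rpow_pos_of_pos hs0 _
    have h4 : 0 ≤ complementaryFn G (s ^ ((1:ℝ) - n) / (R * (K + 1))) := comp_nonneg h (by positivity)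
    have h5 : complementaryFn G (s ^ ((1:ℝ) - n) / (R * (K + 1))) ≤ 1 := by
      have e : s ^ ((1:ℝ) - n) / (R * (K + 1)) ≤ 1 / (K + 1) := by
        rw [div_le_div_iff₀ hl (by positivity)]
        nlinarith
      refine (comp_mono h e).trans ?_
      refine (comp_le_mul h (by positivity) ?_).trans ?_
      · rw [div_le_one (by positivity)]; linarith
      · rw [← hK, one_div, inv_mul_le_iff₀ (by positivity)]; linarith
    rw [Real.norm_of_nonneg (by positivity)]
    exact mul_le_one₀ h5 h3'.le h3

lemma G_measurable_comp (h : IsNFunction G g) {α : Type*} [MeasurableSpace α] {f : α → ℝ}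
    (hf : Measurable f) (h0 : ∀ a, 0 ≤ f a) : Measurable (fun a => G (f a)) := by
  have hm : Monotone (fun t => G (max t 0)) := by
    intro a b hab
    exact h.strictMono.monotoneOn (Set.mem_Ici.2 (le_max_right _ _)) (Set.mem_Ici.2 (le_max_right _ _))
      (max_le_max_right 0 hab)
  have := hm.measurable.comp hf
  convert this using 2 with a
  simp [h0 a]

end helpers

section grad

variable {n : ℕ}

lemma norm_grad (u : EuclideanSpace ℝ (Fin n) → ℝ) (y : EuclideanSpace ℝ (Fin n)) :
    ‖gradient u y‖ = ‖fderiv ℝ u y‖ := by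
  rw [← toDual_gradient, LinearIsometryEquiv.norm_map]

lemma grad_bdd {u : EuclideanSpace ℝ (Fin n) → ℝ} (hu : ContDiffOn ℝ 1 u (closedBall 0 1)) :
    ∃ M, 0 ≤ M ∧ ∀ y ∈ ball (0:EuclideanSpace ℝ (Fin n)) 1, ‖gradient u y‖ ≤ M := by
  have hU : UniqueDiffOn ℝ (closedBall (0:EuclideanSpace ℝ (Fin n)) 1) :=
    uniqueDiffOn_convex (convex_closedBall _ _)
      ⟨0, ball_subset_interior_closedBall (mem_ball_self one_pos)⟩
  have hc := hu.continuousOn_fderivWithin hU le_rfl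
  obtain ⟨M, hM⟩ := (isCompact_closedBall _ _).exists_bound_of_continuousOn hc
  refine ⟨M, (norm_nonneg _).trans (hM 0 (by simp)), fun y hy => ?_⟩
  rw [norm_grad, ← fderivWithin_of_mem_nhds (Filter.mem_of_superset (isOpen_ball.mem_nhds hy) ball_subset_closedBall)]
  exact hM y (ball_subset_closedBall hy)

lemma grad_diff {u : EuclideanSpace ℝ (Fin n) → ℝ} (hu : ContDiffOn ℝ 1 u (closedBall 0 1))
    {y : EuclideanSpace ℝ (Fin n)} (hy : y ∈ ball (0:EuclideanSpace ℝ (Fin n)) 1) :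
    DifferentiableAt ℝ u y :=
  (hu.differentiableOn one_ne_zero).differentiableAt
    (Filter.mem_of_superset (isOpen_ball.mem_nhds hy) ball_subset_closedBall)

lemma grad_meas {G g : ℝ → ℝ} (h : IsNFunction G g) (u : EuclideanSpace ℝ (Fin n) → ℝ) {l : ℝ} (hl : 0 < l) :
    Measurable (fun y => G (‖gradient u y‖ / l)) := by
  apply G_measurable_comp h
  · simp only [norm_grad]
    exact (measurable_fderiv ℝ u).norm.div_const l
  · intro a; positivity

lemma grad_int {G g : ℝ → ℝ} (h : IsNFunction G g) {u : EuclideanSpace ℝ (Fin n) → ℝ}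
    (hu : ContDiffOn ℝ 1 u (closedBall 0 1)) {l : ℝ} (hl : 0 < l) :
    IntegrableOn (fun y => G (‖gradient u y‖ / l)) (ball 0 1) := by
  obtain ⟨M, hM0, hM⟩ := grad_bdd hu
  refine Measure.integrableOn_of_bounded (M := G (M / l)) measure_ball_lt_top.ne
    (grad_meas h u hl).aestronglyMeasurable ?_
  refine ae_restrict_of_forall_mem measurableSet_ball fun y hy => ?_
  rw [Real.norm_of_nonneg (nf_nonneg h (by positivity))]
  refine h.strictMono.monotoneOn (Set.mem_Ici.2 (by positivity)) (Set.mem_Ici.2 (by positivity)) ?_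
  gcongr
  exact hM y hy

lemma grad_nonempty {G g : ℝ → ℝ} (h : IsNFunction G g) {u : EuclideanSpace ℝ (Fin n) → ℝ}
    (hu : ContDiffOn ℝ 1 u (closedBall 0 1)) :
    {l : ℝ | 0 < l ∧ (∫ y in ball (0:EuclideanSpace ℝ (Fin n)) 1, G (‖gradient u y‖ / l)) ≤ 1}.Nonempty := by
  obtain ⟨M, hM0, hM⟩ := grad_bdd hu
  set V := (volume : Measure (EuclideanSpace ℝ (Fin n))).real (ball 0 1)
  have hV : 0 ≤ V := measureReal_nonneg
  have hGM := nf_nonneg h hM0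
  have hl : 0 < G M * V + 1 := by positivity
  refine ⟨_, hl, ?_⟩
  have key := norm_setIntegral_le_of_norm_le_const (μ := (volume : Measure (EuclideanSpace ℝ (Fin n))))
    (s := ball 0 1) (f := fun y => G (‖gradient u y‖ / (G M * V + 1)))
    (C := (1 / (G M * V + 1)) * G M) measure_ball_lt_top ?_
  · refine (le_abs_self _).trans (key.trans ?_)
    change (1 / (G M * V + 1)) * G M * V ≤ 1
    rw [mul_assoc, one_div, inv_mul_le_iff₀ hl]
    linarith
  · intro y hy
    rw [Real.norm_of_nonneg (nf_nonneg h (by positivity))]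
    refine le_trans ?_ (nf_le_mul h (by positivity) M hM0 ?_)
    · refine h.strictMono.monotoneOn (Set.mem_Ici.2 (by positivity)) (Set.mem_Ici.2 (by positivity)) ?_
      rw [one_div_mul_eq_div]
      gcongr
      exact hM y hy
    · rw [div_le_one hl]; nlinarith [mul_nonneg hGM hV]

/-- radial derivative -/
lemma radial_deriv {u : EuclideanSpace ℝ (Fin n) → ℝ} (hu : ContDiffOn ℝ 1 u (closedBall 0 1))
    {e : EuclideanSpace ℝ (Fin n)} (he : ‖e‖ = 1) {s : ℝ} (hs : |s| < 1) :
    HasDerivAt (fun t : ℝ => u (t • e)) (fderiv ℝ u (s • e) e) s := by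
  have hy : s • e ∈ ball (0:EuclideanSpace ℝ (Fin n)) 1 := by simp [norm_smul, he, hs]
  have h1 : HasDerivAt (fun t : ℝ => t • e) e s := by
    simpa using (hasDerivAt_id s).smul_const e
  exact (grad_diff hu hy).hasFDerivAt.comp_hasDerivAt s h1

lemma radial_deriv_le {u : EuclideanSpace ℝ (Fin n) → ℝ} (hu : ContDiffOn ℝ 1 u (closedBall 0 1))
    (hrad : ∀ x ∈ closedBall (0:EuclideanSpace ℝ (Fin n)) 1,
          ∀ y ∈ closedBall (0:EuclideanSpace ℝ (Fin n)) 1, ‖x‖ = ‖y‖ → u x = u y)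
    {e : EuclideanSpace ℝ (Fin n)} (he : ‖e‖ = 1) {y : EuclideanSpace ℝ (Fin n)} (hy : ‖y‖ < 1) :
    |deriv (fun t : ℝ => u (t • e)) ‖y‖| ≤ ‖gradient u y‖ := by
  obtain ⟨e', he', hye⟩ : ∃ e' : EuclideanSpace ℝ (Fin n), ‖e'‖ = 1 ∧ ‖y‖ • e' = y := by
    by_cases h0 : y = 0
    · exact ⟨e, he, by simp [h0]⟩
    · have : ‖y‖ ≠ 0 := norm_ne_zero_iff.2 h0
      exact ⟨‖y‖⁻¹ • y, by simp [norm_smul, this], by simp [smul_smul, this]⟩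
  have hs : |‖y‖| < 1 := by rwa [abs_of_nonneg (norm_nonneg y)]
  have heq : (fun t : ℝ => u (t • e)) =ᶠ[nhds ‖y‖] (fun t : ℝ => u (t • e')) := by
    filter_upwards [(isOpen_lt continuous_abs continuous_const).mem_nhds hs] with t ht
    have ht' : |t| < 1 := ht
    apply hrad <;> simp [norm_smul, he, he', ht'.le]
  rw [heq.deriv_eq, (radial_deriv hu he' hs).deriv, hye, norm_grad]
  simpa [he'] using (fderiv ℝ u y).le_opNorm e'

end grad

lemma strauss_key (n : ℕ) (hn : 2 ≤ n) {G g : ℝ → ℝ} (h : IsNFunction G g)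
    {u : EuclideanSpace ℝ (Fin n) → ℝ} (hu : ContDiffOn ℝ 1 u (closedBall 0 1))
    (hrad : ∀ x ∈ closedBall (0:EuclideanSpace ℝ (Fin n)) 1,
          ∀ y ∈ closedBall (0:EuclideanSpace ℝ (Fin n)) 1, ‖x‖ = ‖y‖ → u x = u y)
    (hbd : ∀ x : EuclideanSpace ℝ (Fin n), ‖x‖ = 1 → u x = 0)
    {x : EuclideanSpace ℝ (Fin n)} (hx1 : ‖x‖ < 1) (hx0 : x ≠ 0) {l m : ℝ} (hl : 0 < l) (hm : 0 < m)
    (hlI : (∫ y in ball (0:EuclideanSpace ℝ (Fin n)) 1, G (‖gradient u y‖ / l)) ≤ 1)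
    (hmI : (∫ s in ‖x‖..1, complementaryFn G (s ^ ((1:ℝ) - n) / m) * s ^ ((n:ℝ) - 1)) ≤ 1) :
    |u x| ≤ (1 + 1 / (n * (volume : Measure (EuclideanSpace ℝ (Fin n))).real (ball 0 1))) * l * m := by
  set V := (volume : Measure (EuclideanSpace ℝ (Fin n))).real (ball 0 1) with hVdef
  have hV : 0 < V := ENNReal.toReal_pos (measure_ball_pos _ _ one_pos).ne' measure_ball_lt_top.ne
  have hn' : (2:ℝ) ≤ n := by exact_mod_cast hn
  have hnV : 0 < n * V := by positivity
  set r := ‖x‖ with hr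
  have hr0 : 0 < r := norm_pos_iff.2 hx0
  obtain ⟨e, he, hxe⟩ : ∃ e : EuclideanSpace ℝ (Fin n), ‖e‖ = 1 ∧ r • e = x := by
    have : r ≠ 0 := hr0.ne'
    exact ⟨r⁻¹ • x, by rw [norm_smul, ← hr, norm_inv, Real.norm_of_nonneg hr0.le]; exact inv_mul_cancel₀ this, by simp [smul_smul, this]⟩
  set v : ℝ → ℝ := fun t => u (t • e) with hv
  obtain ⟨M, hM0, hM⟩ := grad_bdd hu
  have hdb : ∀ s, |s| < 1 → 0 ≤ s → |deriv v s| ≤ M := by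
    intro s hs hs0
    have hns : ‖s • e‖ = s := by simp [norm_smul, he, abs_of_nonneg hs0]
    have hs1 : ‖s • e‖ < 1 := by rw [hns]; exact (le_abs_self s).trans_lt hs
    have := radial_deriv_le hu hrad he hs1
    rw [hns] at this
    exact this.trans (hM _ (by simpa using hs1))
  have hmeas : Measurable (deriv v) := measurable_deriv v
  have hdint : IntervalIntegrable (deriv v) volume r 1 := by
    rw [intervalIntegrable_iff_integrableOn_Ioo_of_le hx1.le]
    refine Measure.integrableOn_of_bounded (M := M) (by simp) hmeas.aestronglyMeasurable ?_
    refine ae_restrict_of_forall_mem measurableSet_Ioo fun s hs => ?_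
    have : 0 < s := hr0.trans hs.1
    exact hdb s (by rw [abs_of_pos this]; exact hs.2) this.le
  have hcont : ContinuousOn v (Set.Icc r 1) := by
    refine hu.continuousOn.comp (by fun_prop) ?_
    intro s hs
    have : 0 < s := hr0.trans_le hs.1
    simp [norm_smul, he, abs_of_pos this, hs.2]
  have hftc : ∫ s in r..1, deriv v s = v 1 - v r := by
    refine intervalIntegral.integral_eq_sub_of_hasDerivAt_of_le hx1.le hcont ?_ hdint
    intro s hs
    have : 0 < s := hr0.trans hs.1
    exact (radial_deriv hu he (by rw [abs_of_pos this]; exact hs.2)).differentiableAt.hasDerivAt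
  have hux : |u x| ≤ ∫ s in r..1, |deriv v s| := by
    have h1 : v 1 = 0 := hbd _ (by simp [he])
    have h2 : v r = u x := by simp [hv, hxe]
    have := intervalIntegral.norm_integral_le_integral_norm (f := deriv v) (μ := volume) hx1.le
    rw [hftc, h1, h2] at this
    simpa using this
  -- the polar part
  set f : ℝ → ℝ := Set.indicator (Set.Iio 1) (fun s => G (|deriv v s| / l)) with hf
  have hGm : Measurable (fun s => G (|deriv v s| / l)) :=
    G_measurable_comp h (hmeas.norm.div_const l) (fun a => by positivity)
  have hfm : Measurable f := hGm.indicator measurableSet_Iio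
  have hf0 : ∀ s, 0 ≤ f s := fun s => Set.indicator_nonneg (fun a _ => nf_nonneg h (by positivity)) s
  set F : EuclideanSpace ℝ (Fin n) → ℝ :=
    Set.indicator (ball 0 1) (fun y => G (‖gradient u y‖ / l)) with hF
  have hFi : Integrable F := (grad_int h hu hl).integrable_indicator measurableSet_ball
  have hfF : ∀ y, f ‖y‖ ≤ F y := by
    intro y
    by_cases hy : ‖y‖ < 1
    · have h1 : f ‖y‖ = G (|deriv v ‖y‖| / l) := Set.indicator_of_mem (Set.mem_Iio.2 hy) _
      have h2 : F y = G (‖gradient u y‖ / l) := Set.indicator_of_mem (by simpa using hy) _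
      rw [h1, h2]
      refine h.strictMono.monotoneOn (Set.mem_Ici.2 (by positivity)) (Set.mem_Ici.2 (by positivity)) ?_
      gcongr
      exact radial_deriv_le hu hrad he hy
    · have h1 : f ‖y‖ = 0 := Set.indicator_of_notMem (by simpa using hy) _
      have h2 : F y = 0 := Set.indicator_of_notMem (by simpa using hy) _
      rw [h1, h2]
  have hfi : Integrable (fun y : EuclideanSpace ℝ (Fin n) => f ‖y‖) := by
    refine hFi.mono' (hfm.comp measurable_norm).aestronglyMeasurable ?_
    exact Filter.Eventually.of_forall fun y => by rw [Real.norm_of_nonneg (hf0 _)]; exact hfF y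
  have hint1 : ∫ y : EuclideanSpace ℝ (Fin n), f ‖y‖ ≤ 1 := by
    refine (integral_mono hfi hFi hfF).trans ?_
    rw [hF, integral_indicator measurableSet_ball]
    exact hlI
  have : Nontrivial (EuclideanSpace ℝ (Fin n)) := ⟨x, 0, hx0⟩
  have hpol := integral_fun_norm_addHaar (volume : Measure (EuclideanSpace ℝ (Fin n))) f
  have hpoli := (integrable_fun_norm_addHaar (volume : Measure (EuclideanSpace ℝ (Fin n))) (f := f)).1 hfi
  simp only [finrank_euclideanSpace, Fintype.card_fin, smul_eq_mul, nsmul_eq_mul] at hpol hpoli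
  rw [hpol] at hint1
  have hsub : IntegrableOn (fun s : ℝ => s ^ (n - 1) * f s) (Set.Ioc r 1) :=
    hpoli.mono_set (fun s hs => hr0.trans hs.1)
  have hint2 : ∫ s in r..1, s ^ (n - 1) * f s ≤ 1 / (n * V) := by
    rw [intervalIntegral.integral_of_le hx1.le]
    have : ∫ s in Set.Ioc r 1, s ^ (n - 1) * f s ≤ ∫ s in Set.Ioi (0:ℝ), s ^ (n - 1) * f s := by
      refine setIntegral_mono_set hpoli ?_ (Filter.Eventually.of_forall fun s hs => hr0.trans hs.1)
      refine ae_restrict_of_forall_mem measurableSet_Ioi fun s hs => ?_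
      have : 0 < s := hs
      exact mul_nonneg (by positivity) (hf0 s)
    refine this.trans ?_
    rw [le_div_iff₀ hnV]
    calc _ = (n:ℝ) * (V * ∫ s in Set.Ioi (0:ℝ), s ^ (n - 1) * f s) := by ring
      _ ≤ 1 := hint1
  have hfI : IntervalIntegrable (fun s : ℝ => s ^ (n - 1) * f s) volume r 1 :=
    (intervalIntegrable_iff_integrableOn_Ioc_of_le hx1.le).2 hsub
  have htI := tail_integrable h n hn hr0 hx1 hm
  have hmain : ∫ s in r..1, |deriv v s| / (l * m) ≤
      ∫ s in r..1, (s ^ (n - 1) * f s +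
        complementaryFn G (s ^ ((1:ℝ) - n) / m) * s ^ ((n:ℝ) - 1)) := by
    refine intervalIntegral.integral_mono_on_of_le_Ioo hx1.le (hdint.norm.div_const _) (hfI.add htI) ?_
    intro s hs
    have hs0 : 0 < s := hr0.trans hs.1
    have h1 : f s = G (|deriv v s| / l) := Set.indicator_of_mem (Set.mem_Iio.2 hs.2) _
    have hp : 0 < s ^ ((n:ℝ) - 1) := Real.rpow_pos_of_pos hs0 _
    have e1 : s ^ (n - 1) = s ^ ((n:ℝ) - 1) := by
      rw [← Real.rpow_natCast, Nat.cast_sub (by omega)]; simp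
    have e2 : s ^ ((1:ℝ) - n) = (s ^ ((n:ℝ) - 1))⁻¹ := by
      rw [← Real.rpow_neg hs0.le]; congr 1; ring
    have hq : 0 < s ^ ((1:ℝ) - n) := Real.rpow_pos_of_pos hs0 _
    have hy := nf_young h (a := |deriv v s| / l) (t := s ^ ((1:ℝ) - n) / m) (by positivity) (by positivity)
    have hy2 := mul_le_mul_of_nonneg_right hy hp.le
    have e3 : |deriv v s| / (l * m) =
        |deriv v s| / l * (s ^ ((1:ℝ) - n) / m) * s ^ ((n:ℝ) - 1) := by
      rw [e2]; field_simp
    rw [h1, e1, e3]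
    linarith
  rw [intervalIntegral.integral_add hfI htI, intervalIntegral.integral_div,
    div_le_iff₀ (by positivity)] at hmain
  refine hux.trans (hmain.trans ?_)
  rw [mul_assoc]
  refine mul_le_mul_of_nonneg_right ?_ (by positivity)
  linarith

theorem strauss_radial_lemma_orlicz (n : ℕ) (hn : 2 ≤ n) :
    ∃ C > (0:ℝ), ∀ G g : ℝ → ℝ, IsNFunction G g →
      ∀ u : EuclideanSpace ℝ (Fin n) → ℝ,
        ContDiffOn ℝ 1 u (closedBall 0 1) →
        (∀ x ∈ closedBall (0:EuclideanSpace ℝ (Fin n)) 1,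
          ∀ y ∈ closedBall (0:EuclideanSpace ℝ (Fin n)) 1, ‖x‖ = ‖y‖ → u x = u y) →
        (∀ x : EuclideanSpace ℝ (Fin n), ‖x‖ = 1 → u x = 0) →
        ∀ x ∈ ball (0:EuclideanSpace ℝ (Fin n)) 1, x ≠ 0 →
          |u x| ≤ C * gradLuxemburgNorm n G u * weightedTailNorm n G ‖x‖ := by
  set C := 1 + 1 / (n * (volume : Measure (EuclideanSpace ℝ (Fin n))).real (ball 0 1)) with hC
  have hC0 : 0 < C := by positivity
  refine ⟨C, hC0, ?_⟩
  intro G g h u hu hrad hbd x hx hx0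
  have hx1 : ‖x‖ < 1 := by simpa using hx
  have hA := grad_nonempty h hu
  have hT := tail_nonempty h n hn (norm_pos_iff.2 hx0) hx1
  have h1 : ∀ m, 0 < m → (∫ s in ‖x‖..1, complementaryFn G (s ^ ((1:ℝ) - n) / m) * s ^ ((n:ℝ) - 1)) ≤ 1 →
      |u x| ≤ C * gradLuxemburgNorm n G u * m := by
    intro m hm hmI
    have : |u x| / (C * m) ≤ gradLuxemburgNorm n G u := by
      refine le_csInf hA ?_
      rintro l ⟨hl, hlI⟩
      rw [div_le_iff₀ (by positivity)]
      have := strauss_key n hn h hu hrad hbd hx1 hx0 hl hm hlI hmI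
      rw [← hC] at this
      linarith
    rw [div_le_iff₀ (by positivity)] at this
    linarith
  have hg0 : 0 ≤ gradLuxemburgNorm n G u := Real.sInf_nonneg fun l hl => hl.1.le
  rcases hg0.eq_or_lt with h0 | h0
  · obtain ⟨m, hm, hmI⟩ := hT
    have := h1 m hm hmI
    rw [← h0] at this ⊢
    simpa using this
  · have : |u x| / (C * gradLuxemburgNorm n G u) ≤ weightedTailNorm n G ‖x‖ := by
      refine le_csInf hT ?_
      rintro m ⟨hm, hmI⟩
      rw [div_le_iff₀ (by positivity)]
      linarith [h1 m hm hmI]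
    rw [div_le_iff₀ (by positivity)] at this
    linarith
end

section
/- Let Ω ⊂ ℝⁿ be a bounded measurable set and let μ be a finite nonnegative measure on Ω that is absolutely continuous with respect to Lebesgue measure. Let G be an N-function satisfying the Δ₂-condition (there exists c > 0 with G(2t) ≤ c G(t) for all t ≥ 0), and let R be an N-function with R ≪ G at infinity, i.e. lim_{t→∞} R(λ t)/G(t) = 0 for every λ > 0. Let (u_k) be a sequence of measurable functions on Ω with sup_k ∫_Ω G(|u_k|) dμ ≤ C₀ < ∞ and u_k → u μ-almost everywhere. Then ∫_Ω G(|u|) dμ ≤ C₀, and for every λ > 0 one has lim_{k→∞} ∫_Ω R(|u_k − u|/λ) dμ = 0; equivalently, u_k → u strongly in the Luxemburg norm of L^R(Ω; dμ). -/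
open MeasureTheory

theorem IsNFunction.nonneg_aux {G g : ℝ → ℝ} (h : IsNFunction G g) {t : ℝ} (ht : 0 ≤ t) :
    0 ≤ G t := by
  rw [← h.map_zero]
  exact h.strictMono.monotoneOn (Set.mem_Ici.2 le_rfl) ht ht

theorem IsNFunction.continuous_abs_aux {G g : ℝ → ℝ} (h : IsNFunction G g) :
    Continuous (fun x : ℝ => G |x|) := by
  have hc : ContinuousOn G (Set.Ici 0) := by
    intro t ht
    rcases eq_or_lt_of_le (show (0:ℝ) ≤ t from ht) with h0 | h0
    · subst h0
      rw [← continuousWithinAt_Ioi_iff_Ici]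
      have h1 : Filter.Tendsto (fun t : ℝ => G t / t * t) (nhdsWithin 0 (Set.Ioi 0))
          (nhds (0 * 0)) :=
        h.tendsto_zero.mul (tendsto_nhdsWithin_of_tendsto_nhds Filter.tendsto_id)
      rw [zero_mul] at h1
      unfold ContinuousWithinAt
      rw [h.map_zero]
      refine h1.congr' ?_
      filter_upwards [self_mem_nhdsWithin] with t ht
      have : t ≠ 0 := ne_of_gt ht
      field_simp
    · exact (h.hasDeriv t h0).continuousAt.continuousWithinAt
  exact hc.comp_continuous continuous_abs (fun x => abs_nonneg x)

/-- Orlicz convergence lemma: let `Ω ⊂ ℝⁿ` be bounded and measurable, `μ` a finite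
nonnegative measure absolutely continuous with respect to Lebesgue measure, `G` an
N-function satisfying the `Δ₂`-condition and `R` an N-function with `R ≪ G` at infinity.
If `(u_k)` is a sequence of measurable functions with `∫_Ω G(|u_k|) dμ ≤ C₀ < ∞` and
`u_k → u` `μ`-a.e. in `Ω`, then `∫_Ω G(|u|) dμ ≤ C₀` and, for every `λ > 0`,
`∫_Ω R(|u_k - u|/λ) dμ → 0`, i.e. `u_k → u` in the Luxemburg norm of `L^R(Ω; dμ)`. -/
theorem orlicz_subordinate_convergence (n : ℕ)
    (Ω : Set (EuclideanSpace ℝ (Fin n)))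
    (hΩbdd : Bornology.IsBounded Ω) (hΩmeas : MeasurableSet Ω)
    (μ : Measure (EuclideanSpace ℝ (Fin n))) [IsFiniteMeasure μ]
    (hac : μ ≪ volume)
    (G g R R' : ℝ → ℝ) (hG : IsNFunction G g) (hR : IsNFunction R R')
    (c : ℝ) (hΔ₂ : ∀ t ≥ (0:ℝ), G (2 * t) ≤ c * G t)
    (hRG : ∀ lam > (0:ℝ),
      Filter.Tendsto (fun t => R (lam * t) / G t) Filter.atTop (nhds 0))
    (uk : ℕ → EuclideanSpace ℝ (Fin n) → ℝ) (u : EuclideanSpace ℝ (Fin n) → ℝ)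
    (hmeas : ∀ k, Measurable (uk k))
    (C₀ : ℝ)
    (hint : ∀ k, IntegrableOn (fun x => G |uk k x|) Ω μ)
    (hbdd : ∀ k, ∫ x in Ω, G |uk k x| ∂μ ≤ C₀)
    (hae : ∀ᵐ x ∂(μ.restrict Ω),
      Filter.Tendsto (fun k => uk k x) Filter.atTop (nhds (u x))) :
    (IntegrableOn (fun x => G |u x|) Ω μ ∧ ∫ x in Ω, G |u x| ∂μ ≤ C₀) ∧
    ∀ lam > (0:ℝ),
      Filter.Tendsto (fun k => ∫ x in Ω, R (|uk k x - u x| / lam) ∂μ)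
        Filter.atTop (nhds 0) := by
  have hGc := hG.continuous_abs_aux
  have hRc := hR.continuous_abs_aux
  have hu : AEMeasurable u (μ.restrict Ω) :=
    aemeasurable_of_tendsto_metrizable_ae Filter.atTop (fun k => (hmeas k).aemeasurable) hae
  have hGu : AEStronglyMeasurable (fun x => G |u x|) (μ.restrict Ω) :=
    (hGc.measurable.comp_aemeasurable hu).aestronglyMeasurable
  have hC0 : 0 ≤ C₀ :=
    (integral_nonneg (fun x => hG.nonneg_aux (abs_nonneg _))).trans (hbdd 0)
  have hfatou : ∫⁻ x in Ω, ENNReal.ofReal (G |u x|) ∂μ ≤ ENNReal.ofReal C₀ := by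
    calc ∫⁻ x in Ω, ENNReal.ofReal (G |u x|) ∂μ
        = ∫⁻ x in Ω, Filter.liminf (fun k => ENNReal.ofReal (G |uk k x|)) Filter.atTop ∂μ := by
          refine lintegral_congr_ae ?_
          filter_upwards [hae] with x hx
          exact (((ENNReal.continuous_ofReal.comp hGc).tendsto (u x)).comp hx).liminf_eq.symm
      _ ≤ Filter.liminf (fun k => ∫⁻ x in Ω, ENNReal.ofReal (G |uk k x|) ∂μ) Filter.atTop :=
          lintegral_liminf_le
            (fun k => ENNReal.measurable_ofReal.comp (hGc.measurable.comp (hmeas k)))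
      _ ≤ ENNReal.ofReal C₀ := by
          refine Filter.liminf_le_of_le (by isBoundedDefault) ?_
          intro b hb
          obtain ⟨k, hk⟩ := hb.exists
          refine hk.trans ?_
          rw [← ofReal_integral_eq_lintegral_ofReal (hint k)
            (Filter.Eventually.of_forall fun x => hG.nonneg_aux (abs_nonneg _))]
          exact ENNReal.ofReal_le_ofReal (hbdd k)
  have hGui : IntegrableOn (fun x => G |u x|) Ω μ := by
    refine ⟨hGu, ?_⟩
    rw [hasFiniteIntegral_iff_ofReal
      (Filter.Eventually.of_forall fun x => hG.nonneg_aux (abs_nonneg _))]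
    exact hfatou.trans_lt ENNReal.ofReal_lt_top
  have hGub : ∫ x in Ω, G |u x| ∂μ ≤ C₀ := by
    rw [integral_eq_lintegral_of_nonneg_ae
      (Filter.Eventually.of_forall fun x => hG.nonneg_aux (abs_nonneg _)) hGu]
    exact ENNReal.toReal_le_of_le_ofReal hC0 hfatou
  refine ⟨⟨hGui, hGub⟩, ?_⟩
  intro lam hlam
  have hRnn : ∀ k x, 0 ≤ R (|uk k x - u x| / lam) :=
    fun k x => hR.nonneg_aux (by positivity)
  have hIn : ∀ k, 0 ≤ ∫ x in Ω, R (|uk k x - u x| / lam) ∂μ :=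
    fun k => integral_nonneg (hRnn k)
  have hRabs : ∀ k x, R (|uk k x - u x| / lam) = R |(uk k x - u x) / lam| := by
    intro k x
    rw [abs_div, abs_of_pos hlam]
  rw [Metric.tendsto_atTop']
  intro ε hε
  set δ := ε / (2 * (C₀ + 1)) with hδ
  have hδ0 : 0 < δ := by positivity
  obtain ⟨S, hS⟩ := Filter.eventually_atTop.1
    (((hRG (2 / lam) (by positivity)).eventually (gt_mem_nhds hδ0)).and
      (Filter.eventually_gt_atTop (0:ℝ)))
  have hSpos : 0 < S := (hS S le_rfl).2
  set M := R (2 / lam * S) with hM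
  have hM0 : 0 ≤ M := hR.nonneg_aux (by positivity)
  have hpt : ∀ k x, R (|uk k x - u x| / lam) ≤
      min (R (|uk k x - u x| / lam)) M + δ * ((1/2) * G |uk k x| + (1/2) * G |u x|) := by
    intro k x
    have hGk := hG.nonneg_aux (abs_nonneg (uk k x))
    have hGx := hG.nonneg_aux (abs_nonneg (u x))
    rcases le_total (|uk k x - u x| / 2) S with h | h
    · have h1 : R (|uk k x - u x| / lam) ≤ M := by
        refine hR.strictMono.monotoneOn (Set.mem_Ici.2 (by positivity))
          (Set.mem_Ici.2 (by positivity)) ?_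
        have : |uk k x - u x| / lam = 2 / lam * (|uk k x - u x| / 2) := by ring
        rw [this]
        gcongr
      rw [min_eq_left h1]
      have : 0 ≤ δ * ((1/2) * G |uk k x| + (1/2) * G |u x|) := by positivity
      linarith
    · obtain ⟨h1, h2⟩ := hS _ h
      have hGpos : 0 < G (|uk k x - u x| / 2) := by
        rw [← hG.map_zero]
        exact hG.strictMono (Set.mem_Ici.2 le_rfl) (Set.mem_Ici.2 h2.le) h2
      rw [div_lt_iff₀ hGpos] at h1
      have e : 2 / lam * (|uk k x - u x| / 2) = |uk k x - u x| / lam := by ring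
      rw [e] at h1
      have h3 : G (|uk k x - u x| / 2) ≤ (1/2) * G |uk k x| + (1/2) * G |u x| := by
        have h4 := hG.convex.2 (Set.mem_Ici.2 (abs_nonneg (uk k x)))
          (Set.mem_Ici.2 (abs_nonneg (u x))) (show (0:ℝ) ≤ 1/2 by norm_num)
          (show (0:ℝ) ≤ 1/2 by norm_num) (by norm_num)
        simp only [smul_eq_mul] at h4
        refine le_trans ?_ h4
        refine hG.strictMono.monotoneOn (Set.mem_Ici.2 (by positivity))
          (Set.mem_Ici.2 (by positivity)) ?_
        have := abs_sub (uk k x) (u x)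
        linarith
      have h5 := mul_le_mul_of_nonneg_left h3 hδ0.le
      have h6 : 0 ≤ min (R (|uk k x - u x| / lam)) M := le_min (hRnn k x) hM0
      linarith
  have hmm : ∀ k, AEStronglyMeasurable (fun x => min (R (|uk k x - u x| / lam)) M)
      (μ.restrict Ω) := by
    intro k
    simp_rw [hRabs]
    exact ((hRc.measurable.comp_aemeasurable
      (((hmeas k).aemeasurable.sub hu).div_const lam)).min aemeasurable_const).aestronglyMeasurable
  have hbd : ∀ k x, ‖min (R (|uk k x - u x| / lam)) M‖ ≤ M := by
    intro k x
    rw [Real.norm_of_nonneg (le_min (hRnn k x) hM0)]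
    exact min_le_right _ _
  have hmi : ∀ k, Integrable (fun x => min (R (|uk k x - u x| / lam)) M) (μ.restrict Ω) :=
    fun k => Integrable.of_bound (hmm k) M (Filter.Eventually.of_forall (hbd k))
  have hdct : Filter.Tendsto (fun k => ∫ x in Ω, min (R (|uk k x - u x| / lam)) M ∂μ)
      Filter.atTop (nhds (∫ x in Ω, (0:ℝ) ∂μ)) := by
    refine tendsto_integral_of_dominated_convergence (fun _ => M) hmm (integrable_const _)
      (fun k => Filter.Eventually.of_forall (hbd k)) ?_
    filter_upwards [hae] with x hx
    have hz : Filter.Tendsto (fun k => (uk k x - u x) / lam) Filter.atTop (nhds 0) := by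
      have := (hx.sub_const (u x)).div_const lam
      simpa using this
    have h1 : Filter.Tendsto (fun k => min (R |(uk k x - u x) / lam|) M) Filter.atTop
        (nhds (min (R |0|) M)) :=
      ((hRc.tendsto 0).comp hz).min tendsto_const_nhds
    rw [abs_zero, hR.map_zero, min_eq_left hM0] at h1
    simpa only [hRabs] using h1
  rw [integral_zero] at hdct
  obtain ⟨N, hN⟩ := Filter.eventually_atTop.1
    (hdct.eventually (gt_mem_nhds (half_pos hε)))
  refine ⟨N, fun k hk => ?_⟩
  have hNk := hN k hk.le
  rw [Real.dist_eq, sub_zero, abs_of_nonneg (hIn k)]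
  have hi2 : Integrable (fun x => δ * ((1/2) * G |uk k x| + (1/2) * G |u x|)) (μ.restrict Ω) :=
    (((hint k).const_mul (1/2)).add (Integrable.const_mul hGui (1/2))).const_mul δ
  have hle : ∫ x in Ω, R (|uk k x - u x| / lam) ∂μ ≤
      ∫ x in Ω, (min (R (|uk k x - u x| / lam)) M +
        δ * ((1/2) * G |uk k x| + (1/2) * G |u x|)) ∂μ :=
    integral_mono_of_nonneg (Filter.Eventually.of_forall (hRnn k)) ((hmi k).add hi2)
      (Filter.Eventually.of_forall (hpt k))
  rw [integral_add (hmi k) hi2, integral_const_mul,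
    integral_add ((hint k).const_mul (1/2)) (Integrable.const_mul hGui (1/2)),
    integral_const_mul, integral_const_mul] at hle
  have h7 : δ * (1/2 * ∫ x in Ω, G |uk k x| ∂μ + 1/2 * ∫ x in Ω, G |u x| ∂μ) ≤ δ * (C₀ + 1) := by
    refine mul_le_mul_of_nonneg_left ?_ hδ0.le
    have := hbdd k
    linarith
  have h8 : δ * (C₀ + 1) = ε / 2 := by
    rw [hδ]
    field_simp
  linarith
end

section
/- Let n ≥ 2 be an integer, 1 < p < n, and let B be the open unit ball of ℝⁿ. There exists a constant C > 0 depending only on n and p such that for every radial function u ∈ C¹(B̄) vanishing on ∂B and every x ∈ B with x ≠ 0: |u(x)| ≤ C |x|^{1 − n/p} (∫_B |∇u(y)|^p dy)^{1/p}. -/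
open MeasureTheory Metric

lemma strauss_memLp {ρ : ℝ} {f : ℝ → ℝ} (hf : ContinuousOn f (Set.Icc ρ 1))
    (q : ENNReal) : MemLp f q (volume.restrict (Set.Ioo ρ 1)) := by
  obtain ⟨C, hC⟩ := isCompact_Icc.exists_bound_of_continuousOn hf
  refine MemLp.of_bound
    ((hf.mono Set.Ioo_subset_Icc_self).aestronglyMeasurable measurableSet_Ioo) C ?_
  exact (ae_restrict_iff' measurableSet_Ioo).2
    (Filter.Eventually.of_forall fun x hx => hC x (Set.Ioo_subset_Icc_self hx))

lemma strauss_one_dim (n : ℕ) (hn : 2 ≤ n) (p : ℝ) (hp : 1 < p) (hpn : p < n) (ρ : ℝ)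
    (hρ : 0 < ρ) (hρ1 : ρ < 1) (ψ : ℝ → ℝ) (hψ : ContinuousOn ψ (Set.Icc ρ 1)) :
    ∫ t in Set.Ioo ρ 1, |ψ t| ≤
      (∫ t in Set.Ioo ρ 1, t ^ (n - 1) * |ψ t| ^ p) ^ (1 / p) *
        (((p - 1) / (n - p)) ^ ((p - 1) / p) * ρ ^ (1 - (n:ℝ) / p)) := by
  have hp0 : 0 < p := by linarith
  have hp1 : 0 < p - 1 := by linarith
  have hnp : 0 < (n:ℝ) - p := by linarith
  have hq : p.HolderConjugate (p / (p - 1)) := Real.HolderConjugate.conjExponent hp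
  set a : ℝ := ((n:ℝ) - 1) / p with ha
  have hcpow : ∀ b : ℝ, ContinuousOn (fun t : ℝ => t ^ b) (Set.Icc ρ 1) := fun b =>
    continuousOn_id.rpow_const (fun t ht => Or.inl (hρ.trans_le ht.1).ne')
  have hH := integral_mul_le_Lp_mul_Lq_of_nonneg (μ := volume.restrict (Set.Ioo ρ 1)) hq
    (f := fun t => t ^ a * |ψ t|) (g := fun t => t ^ (-a)) ?_ ?_
    (strauss_memLp ((hcpow a).mul hψ.abs) _) (strauss_memLp (hcpow _) _)
  rotate_left
  · refine (ae_restrict_iff' measurableSet_Ioo).2 (Filter.Eventually.of_forall fun t ht => ?_)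
    have : 0 < t := hρ.trans ht.1
    simp only [Pi.zero_apply]; positivity
  · refine (ae_restrict_iff' measurableSet_Ioo).2 (Filter.Eventually.of_forall fun t ht => ?_)
    have : 0 < t := hρ.trans ht.1
    simp only [Pi.zero_apply]; positivity
  have e1 : ∫ t in Set.Ioo ρ 1, t ^ a * |ψ t| * t ^ (-a) = ∫ t in Set.Ioo ρ 1, |ψ t| := by
    refine setIntegral_congr_fun measurableSet_Ioo fun t ht => ?_
    have h0 : 0 < t := hρ.trans ht.1
    have : t ^ a * t ^ (-a) = 1 := by rw [← Real.rpow_add h0]; simp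
    linear_combination |ψ t| * this
  have e2 : ∫ t in Set.Ioo ρ 1, (t ^ a * |ψ t|) ^ p
      = ∫ t in Set.Ioo ρ 1, t ^ (n - 1) * |ψ t| ^ p := by
    refine setIntegral_congr_fun measurableSet_Ioo fun t ht => ?_
    have h0 : 0 < t := hρ.trans ht.1
    rw [Real.mul_rpow (by positivity) (abs_nonneg _), ← Real.rpow_mul h0.le, ha,
      div_mul_cancel₀ _ hp0.ne', ← Real.rpow_natCast, Nat.cast_sub (by omega), Nat.cast_one]
  set b : ℝ := ((n:ℝ) - 1) / (p - 1) with hb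
  have hb1 : b - 1 = (n - p) / (p - 1) := by rw [hb]; field_simp; ring
  have hb1' : 0 < b - 1 := by rw [hb1]; positivity
  have e3 : ∫ t in Set.Ioo ρ 1, (t ^ (-a)) ^ (p / (p - 1))
      = ∫ t in Set.Ioo ρ 1, t ^ (-b) := by
    refine setIntegral_congr_fun measurableSet_Ioo fun t ht => ?_
    have h0 : 0 < t := hρ.trans ht.1
    rw [← Real.rpow_mul h0.le]
    congr 1
    rw [ha, hb]; field_simp
  have e4 : ∫ t in Set.Ioo ρ 1, t ^ (-b) = (ρ ^ (1 - b) - 1) / (b - 1) := by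
    rw [← integral_Ioc_eq_integral_Ioo, ← intervalIntegral.integral_of_le hρ1.le, integral_rpow]
    · rw [Real.one_rpow, show -b + 1 = 1 - b by ring, ← neg_sub b 1, div_neg, ← neg_div]
      ring
    · right
      refine ⟨by intro h; linarith, ?_⟩
      rw [Set.uIcc_of_le hρ1.le]
      intro h; exact absurd h.1 (not_le.2 hρ)
  have e4n : 0 ≤ ∫ t in Set.Ioo ρ 1, t ^ (-b) :=
    setIntegral_nonneg measurableSet_Ioo fun t ht =>
      Real.rpow_nonneg (hρ.trans ht.1).le _
  have e5 : (∫ t in Set.Ioo ρ 1, t ^ (-b)) ^ (1 / (p / (p - 1))) ≤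
      ((p - 1) / (n - p)) ^ ((p - 1) / p) * ρ ^ (1 - (n:ℝ) / p) := by
    have : ∫ t in Set.Ioo ρ 1, t ^ (-b) ≤ (p - 1) / (n - p) * ρ ^ (1 - b) := by
      rw [e4, hb1, div_div_eq_mul_div, div_mul_eq_mul_div]
      refine div_le_div_of_nonneg_right ?_ hnp.le
      nlinarith
    rw [one_div_div]
    refine (Real.rpow_le_rpow e4n this (by positivity)).trans (le_of_eq ?_)
    rw [Real.mul_rpow (by positivity) (by positivity), ← Real.rpow_mul hρ.le]
    congr 2
    rw [← neg_sub b 1, hb1]; field_simp; ring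
  rw [e1, e2, e3] at hH
  refine hH.trans (mul_le_mul_of_nonneg_left e5 (Real.rpow_nonneg ?_ _))
  refine setIntegral_nonneg measurableSet_Ioo fun t ht => ?_
  have h0 : 0 < t := hρ.trans ht.1
  positivity

/-- Strauss' radial lemma in `W^{1,p}_0(B)`, `B` the unit ball of `ℝⁿ`, `n ≥ 2`, `1 < p < n`:
there is `C = C(n,p) > 0` such that every radial `u ∈ C¹(B̄)` vanishing on `∂B` satisfies
`|u(x)| ≤ C |x|^{1-n/p} (∫_B |∇u|^p)^{1/p}` for all `x ∈ B`, `x ≠ 0`. -/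
theorem strauss_radial_lemma_power (n : ℕ) (hn : 2 ≤ n) (p : ℝ) (hp : 1 < p) (hpn : p < n) :
    ∃ C > (0:ℝ), ∀ u : EuclideanSpace ℝ (Fin n) → ℝ,
      ContDiffOn ℝ 1 u (closedBall 0 1) →
      (∀ x ∈ closedBall (0:EuclideanSpace ℝ (Fin n)) 1,
        ∀ y ∈ closedBall (0:EuclideanSpace ℝ (Fin n)) 1, ‖x‖ = ‖y‖ → u x = u y) →
      (∀ x : EuclideanSpace ℝ (Fin n), ‖x‖ = 1 → u x = 0) →
      ∀ x ∈ ball (0:EuclideanSpace ℝ (Fin n)) 1, x ≠ 0 →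
        |u x| ≤ C * ‖x‖ ^ (1 - (n:ℝ) / p) *
          (∫ y in ball (0:EuclideanSpace ℝ (Fin n)) 1, ‖gradient u y‖ ^ p) ^ (1 / p) := by
  have hp0 : 0 < p := by linarith
  have hp1 : 0 < p - 1 := by linarith
  have hnp : 0 < (n:ℝ) - p := by linarith
  have hn0 : (0:ℝ) < n := by linarith
  set V : ℝ := n * (volume : Measure (EuclideanSpace ℝ (Fin n))).real (ball 0 1) with hV
  have hV0 : 0 < V := by
    refine mul_pos hn0 ?_
    rw [measureReal_def]
    exact ENNReal.toReal_pos (measure_ball_pos _ _ one_pos).ne' measure_ball_lt_top.ne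
  set K : ℝ := ((p - 1) / (n - p)) ^ ((p - 1) / p) with hK
  have hK0 : 0 < K := by positivity
  refine ⟨K * (V⁻¹) ^ (1 / p), by positivity, ?_⟩
  intro u hu hrad hbd x hx hx0
  set S := closedBall (0:EuclideanSpace ℝ (Fin n)) 1 with hS
  have hUD : UniqueDiffOn ℝ S := by
    refine uniqueDiffOn_convex (convex_closedBall _ _) ?_
    rw [interior_closedBall _ one_ne_zero]
    exact ⟨0, by simp⟩
  have hnhds : ∀ y ∈ ball (0:EuclideanSpace ℝ (Fin n)) 1, S ∈ nhds y := fun y hy =>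
    Filter.mem_of_superset (isOpen_ball.mem_nhds hy) ball_subset_closedBall
  have hfd : ∀ y ∈ ball (0:EuclideanSpace ℝ (Fin n)) 1, HasFDerivAt u (fderivWithin ℝ u S y) y :=
    fun y hy => ((hu.differentiableOn one_ne_zero y
      (ball_subset_closedBall hy)).hasFDerivWithinAt).hasFDerivAt (hnhds y hy)
  have hcD : ContinuousOn (fderivWithin ℝ u S) S := hu.continuousOn_fderivWithin hUD le_rfl
  have hgrad : ∀ y ∈ ball (0:EuclideanSpace ℝ (Fin n)) 1,
      ‖gradient u y‖ = ‖fderivWithin ℝ u S y‖ := by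
    intro y hy
    rw [gradient, LinearIsometryEquiv.norm_map, (hfd y hy).fderiv]
  -- integrability of the right-hand side
  have hint : IntegrableOn (fun y => ‖gradient u y‖ ^ p)
      (ball (0:EuclideanSpace ℝ (Fin n)) 1) := by
    have h1 : IntegrableOn (fun y => ‖fderivWithin ℝ u S y‖ ^ p) S := by
      refine ContinuousOn.integrableOn_compact (isCompact_closedBall _ _) ?_
      exact hcD.norm.rpow_const fun _ _ => Or.inr hp0.le
    refine (h1.mono_set ball_subset_closedBall).congr_fun (fun y hy => ?_) measurableSet_ball
    simp only
    rw [hgrad y hy]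
  set ρ := ‖x‖ with hρ
  have hρ0 : 0 < ρ := norm_pos_iff.2 hx0
  have hρ1 : ρ < 1 := by simpa using hx
  set e := ρ⁻¹ • x with he
  have hen : ‖e‖ = 1 := by
    rw [he, norm_smul, norm_inv, Real.norm_of_nonneg hρ0.le, ← hρ, inv_mul_cancel₀ hρ0.ne']
  have hnt : ∀ ω : EuclideanSpace ℝ (Fin n), ‖ω‖ = 1 → ∀ t : ℝ, 0 ≤ t → ‖t • ω‖ = t :=
    fun ω hω t ht => by rw [norm_smul, hω, mul_one, Real.norm_of_nonneg ht]
  set ψ : ℝ → ℝ := fun t => fderivWithin ℝ u S (t • e) e with hψd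
  have hmaps : Set.MapsTo (fun t : ℝ => t • e) (Set.Icc ρ 1) S := fun t ht => by
    rw [hS, mem_closedBall_zero_iff, hnt e hen t (hρ0.le.trans ht.1)]; exact ht.2
  have hcs : Continuous (fun t : ℝ => t • e) := by fun_prop
  have hψ : ContinuousOn ψ (Set.Icc ρ 1) :=
    (hcD.comp hcs.continuousOn hmaps).clm_apply continuousOn_const
  have hder : ∀ ω : EuclideanSpace ℝ (Fin n), ‖ω‖ = 1 → ∀ t ∈ Set.Ioo (0:ℝ) 1,
      HasDerivAt (fun s : ℝ => u (s • ω)) (fderivWithin ℝ u S (t • ω) ω) t := by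
    intro ω hω t ht
    have hb : t • ω ∈ ball (0:EuclideanSpace ℝ (Fin n)) 1 := by
      rw [mem_ball_zero_iff, hnt ω hω t ht.1.le]; exact ht.2
    have h1 : HasDerivAt (fun s : ℝ => s • ω) ω t := by
      simpa using (hasDerivAt_id t).smul_const ω
    exact (hfd _ hb).comp_hasDerivAt t h1
  -- fundamental theorem of calculus
  have hux : |u x| ≤ ∫ t in Set.Ioo ρ 1, |ψ t| := by
    have hftc := intervalIntegral.integral_eq_sub_of_hasDerivAt_of_le (f' := ψ)
      (f := fun s : ℝ => u (s • e)) hρ1.le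
      (hu.continuousOn.comp hcs.continuousOn hmaps)
      (fun t ht => hder e hen t ⟨hρ0.trans ht.1, ht.2⟩)
      (hψ.intervalIntegrable_of_Icc hρ1.le)
    have hxe : ρ • e = x := by rw [he, smul_smul, mul_inv_cancel₀ hρ0.ne', one_smul]
    simp only [one_smul, hxe, hbd e hen, zero_sub] at hftc
    rw [← abs_neg, ← hftc, ← integral_Ioc_eq_integral_Ioo,
      ← intervalIntegral.integral_of_le hρ1.le]
    exact intervalIntegral.abs_integral_le_integral_abs hρ1.le
  -- radial comparison
  have hcmp : ∀ y : EuclideanSpace ℝ (Fin n), ‖y‖ ∈ Set.Ioo ρ 1 → |ψ ‖y‖| ≤ ‖gradient u y‖ := by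
    intro y hy
    have hy0 : 0 < ‖y‖ := hρ0.trans hy.1
    set ω := ‖y‖⁻¹ • y with hω
    have hωn : ‖ω‖ = 1 := by
      rw [hω, norm_smul, norm_inv, norm_norm, inv_mul_cancel₀ hy0.ne']
    have hyω : ‖y‖ • ω = y := by rw [hω, smul_smul, mul_inv_cancel₀ hy0.ne', one_smul]
    have d1 := hder e hen ‖y‖ ⟨hy0, hy.2⟩
    have d2 := hder ω hωn ‖y‖ ⟨hy0, hy.2⟩
    have heq : (fun s : ℝ => u (s • e)) =ᶠ[nhds ‖y‖] fun s : ℝ => u (s • ω) := by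
      filter_upwards [isOpen_Ioo.mem_nhds (⟨hy0, hy.2⟩ : ‖y‖ ∈ Set.Ioo (0:ℝ) 1)] with s hs
      refine hrad _ ?_ _ ?_ ?_
      · rw [hS, mem_closedBall_zero_iff, hnt e hen s hs.1.le]; exact hs.2.le
      · rw [hS, mem_closedBall_zero_iff, hnt ω hωn s hs.1.le]; exact hs.2.le
      · rw [hnt e hen s hs.1.le, hnt ω hωn s hs.1.le]
    have h := (d2.congr_of_eventuallyEq heq).unique d1
    rw [hyω] at h
    have hyb : y ∈ ball (0:EuclideanSpace ℝ (Fin n)) 1 := by simpa using hy.2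
    rw [hgrad y hyb]
    simp only [hψd]
    rw [← h, ← Real.norm_eq_abs]
    simpa [hωn] using (fderivWithin ℝ u S y).le_opNorm ω
  set I := ∫ y in ball (0:EuclideanSpace ℝ (Fin n)) 1, ‖gradient u y‖ ^ p with hI
  set J := ∫ t in Set.Ioo ρ 1, t ^ (n - 1) * |ψ t| ^ p with hJ
  have hJ0 : 0 ≤ J := by
    refine setIntegral_nonneg measurableSet_Ioo fun t ht => ?_
    have h0 : 0 < t := hρ0.trans ht.1
    positivity
  have hVJ : V * J ≤ I := by
    have hsn : Nontrivial (EuclideanSpace ℝ (Fin n)) := ⟨x, 0, hx0⟩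
    have h1 := integral_fun_norm_addHaar (volume : Measure (EuclideanSpace ℝ (Fin n)))
      ((Set.Ioo ρ 1).indicator fun t => |ψ t| ^ p)
    have h2 : ∫ t in Set.Ioi (0:ℝ), t ^ (n - 1) • (Set.Ioo ρ 1).indicator (fun t => |ψ t| ^ p) t
        = J := by
      have : (fun t : ℝ => t ^ (n - 1) • (Set.Ioo ρ 1).indicator (fun t => |ψ t| ^ p) t)
          = (Set.Ioo ρ 1).indicator fun t => t ^ (n - 1) * |ψ t| ^ p := by
        ext t
        by_cases ht : t ∈ Set.Ioo ρ 1 <;> simp [ht]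
      rw [this, setIntegral_indicator measurableSet_Ioo, Set.inter_eq_self_of_subset_right]
      exact fun t ht => hρ0.trans ht.1
    rw [finrank_euclideanSpace_fin, h2, nsmul_eq_mul, smul_eq_mul, ← mul_assoc] at h1
    rw [hV, ← h1, hI, ← integral_indicator measurableSet_ball]
    refine integral_mono_of_nonneg (Filter.Eventually.of_forall fun y => ?_)
      (hint.integrable_indicator measurableSet_ball) (Filter.Eventually.of_forall fun y => ?_)
    · exact Set.indicator_nonneg (fun t _ => by positivity) _
    · by_cases hy : ‖y‖ ∈ Set.Ioo ρ 1
      · have hyb : y ∈ ball (0:EuclideanSpace ℝ (Fin n)) 1 := by simpa using hy.2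
        simp only [Set.indicator_of_mem hy, Set.indicator_of_mem hyb]
        exact Real.rpow_le_rpow (abs_nonneg _) (hcmp y hy) hp0.le
      · simp only [Set.indicator_of_notMem hy]
        exact Set.indicator_nonneg (fun t _ => by positivity) _
  have hJI : J ≤ V⁻¹ * I := by
    rw [inv_mul_eq_div, le_div_iff₀ hV0]; linarith
  have hI0 : 0 ≤ I := le_trans (by positivity) hVJ
  calc |u x| ≤ ∫ t in Set.Ioo ρ 1, |ψ t| := hux
    _ ≤ J ^ (1 / p) * (K * ρ ^ (1 - (n:ℝ) / p)) :=
        strauss_one_dim n hn p hp hpn ρ hρ0 hρ1 ψ hψ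
    _ ≤ (V⁻¹ * I) ^ (1 / p) * (K * ρ ^ (1 - (n:ℝ) / p)) := by gcongr
    _ = K * (V⁻¹) ^ (1 / p) * ρ ^ (1 - (n:ℝ) / p) * I ^ (1 / p) := by
        rw [Real.mul_rpow (by positivity) hI0]; ring
end
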